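/- Let (A_i)_{i∈ℕ} be a sequence of arcs in K with endpoints ā_i and b̄_i respectively. Suppose there is M > 0 such that d̄(ā_i, b̄_i) ≤ M for each i (i.e., for each i there is m_i ∈ ℕ with π_{m_i} restricted to A_i injective and s^{m_i} · |π_{m_i}(ā_i) − π_{m_i}(b̄_i)| ≤ M), and suppose ā_i converges to some point ā ∈ K. Then B = limsup A_i is an arc in K (possibly degenerate, i.e., a single point) and ℓ(B) ≤ 2M. -/

import Mathlib

open Set Filter Topology Function

noncomputable section

/-- The tent map with slope `s`. -/
def tent (s : ℝ) (x : ℝ) : ℝ := min (s * x) (s * (1 - x))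

/-- The ω-limit set of `c` under iteration of `f`. -/
def omegaSet (f : ℝ → ℝ) (c : ℝ) : Set ℝ :=
  {y | ∃ φ : ℕ → ℕ, StrictMono φ ∧ Tendsto (fun k => f^[φ k] c) atTop (𝓝 y)}

/-- The inverse limit space `K = lim←([0,1], T)`, as a subset of `ℕ → ℝ`. -/
def invLim (s : ℝ) : Set (ℕ → ℝ) :=
  {x | (∀ n, x n ∈ Icc (0 : ℝ) 1) ∧ ∀ n, x n = tent s (x (n + 1))}

/-- The `n`-th coordinate projection `π_n : K → [0,1]`. -/
def proj (s : ℝ) (n : ℕ) (x : invLim s) : ℝ := (x : ℕ → ℝ) n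

/-- The inverse shift homeomorphism `σ̂⁻¹(x₀,x₁,…) = (x₁,x₂,…)` as a map `K → K`. -/
def shiftInvFun (s : ℝ) (x : invLim s) : invLim s :=
  ⟨fun n => (x : ℕ → ℝ) (n + 1), fun n => x.2.1 (n + 1), fun n => x.2.2 (n + 1)⟩

/-- The shift homeomorphism `σ̂(x₀,x₁,…) = (T x₀, x₀, x₁, …)` as a map `K → K`. -/
def shiftFwdFun (s : ℝ) (hs1 : Real.sqrt 2 < s) (hs2 : s < 2) (x : invLim s) : invLim s := by
  refine ⟨fun n => Nat.casesOn n (tent s ((x : ℕ → ℝ) 0)) (fun k => (x : ℕ → ℝ) k), ?_, ?_⟩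
  · intro n
    cases n with
    | zero =>
      have hx0 := x.2.1 0
      have hs0 : 0 ≤ s := le_of_lt (lt_of_le_of_lt (Real.sqrt_nonneg 2) hs1)
      constructor
      · exact le_min (mul_nonneg hs0 hx0.1) (mul_nonneg hs0 (by linarith [hx0.2]))
      · rcases le_total ((x : ℕ → ℝ) 0) (1 / 2) with hc | hc
        · exact le_trans (min_le_left _ _) (by nlinarith [hx0.1, hx0.2])
        · exact le_trans (min_le_right _ _) (by nlinarith [hx0.1, hx0.2])
    | succ k => exact x.2.1 k
  · intro n
    cases n with
    | zero => rfl
    | succ k => exact x.2.2 k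

/-- The integer power `σ̂^b` of the shift homeomorphism : for `b ≥ 0` it is the `b`-th iterate
of `σ̂`, and for `b < 0` the `|b|`-th iterate of `σ̂⁻¹`. -/
def shiftZ (s : ℝ) (hs1 : Real.sqrt 2 < s) (hs2 : s < 2) (b : ℤ) : invLim s → invLim s :=
  if 0 ≤ b then (shiftFwdFun s hs1 hs2)^[b.toNat] else (shiftInvFun s)^[(-b).toNat]

/-- The set `F` of folding points of `K`. -/
def foldingPts (s : ℝ) : Set (invLim s) :=
  {x | ∀ n, proj s n x ∈ omegaSet (tent s) (1 / 2)}

/-- The set `E_p` of `p`-points of `K`. -/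
def pPoints (s : ℝ) (p : ℕ) : Set (invLim s) :=
  {x | ∃ n, p < n ∧ proj s n x = 1 / 2}

/-- `A` is an arc with endpoints `a` and `b`. -/
def IsArcWith {X : Type*} [TopologicalSpace X] (A : Set X) (a b : X) : Prop :=
  ∃ f : unitInterval → X, Topology.IsEmbedding f ∧ range f = A ∧ f 0 = a ∧ f 1 = b

/-- `A` is an arc (a homeomorphic copy of `[0,1]`). -/
def IsArc {X : Type*} [TopologicalSpace X] (A : Set X) : Prop :=
  ∃ a b, IsArcWith A a b

/-- `A` is an arc with endpoints `a`, `b`, possibly degenerate (a single point when `a = b`). -/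
def IsArcBtw {X : Type*} [TopologicalSpace X] (A : Set X) (a b : X) : Prop :=
  IsArcWith A a b ∨ (a = b ∧ A = {a})

/-- `A` is an arc, possibly degenerate (i.e. a single point). -/
def IsArcOrPoint {X : Type*} [TopologicalSpace X] (A : Set X) : Prop :=
  IsArc A ∨ ∃ x, A = {x}

/-- The composant of a point `x`: the union of all proper subcontinua containing `x`. -/
def composant {X : Type*} [TopologicalSpace X] (x : X) : Set X :=
  {y | ∃ A : Set X, IsCompact A ∧ IsConnected A ∧ A ≠ univ ∧ x ∈ A ∧ y ∈ A}

/-- `g` preserves the order along composants: for every composant `C` and every continuous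
bijection `φ` from `ℝ` (respectively from `[0,∞)`) onto `C`, the map `φ⁻¹ ∘ g ∘ φ` is strictly
increasing. -/
def PreservesCompOrder {X : Type*} [TopologicalSpace X] (g : X → X) : Prop :=
  ∀ x : X,
    (∀ φ : ℝ → X, Continuous φ → Injective φ → range φ = composant x →
      ∀ t t' u u' : ℝ, g (φ t) = φ u → g (φ t') = φ u' → t < t' → u < u') ∧
    (∀ φ : {r : ℝ // (0 : ℝ) ≤ r} → X, Continuous φ → Injective φ → range φ = composant x →
      ∀ t t' u u', g (φ t) = φ u → g (φ t') = φ u' → t < t' → u < u')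

/-- Two self-maps of `X` are isotopic if there is a continuous `H : X × [0,1] → X` joining them
through homeomorphisms. -/
def Isotopic {X : Type*} [TopologicalSpace X] (f g : X → X) : Prop :=
  ∃ H : X × unitInterval → X, Continuous H ∧ (∀ x, H (x, 0) = f x) ∧ (∀ x, H (x, 1) = g x) ∧
    ∀ t : unitInterval, IsHomeomorph fun x => H (x, t)

/-- The topological limsup of a sequence of subsets. -/
def setLimsup {X : Type*} [TopologicalSpace X] (D : ℕ → Set X) : Set X :=
  {y | ∃ φ : ℕ → ℕ, StrictMono φ ∧ ∃ z : ℕ → X, (∀ k, z k ∈ D (φ k)) ∧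
    Tendsto z atTop (𝓝 y)}

/-- The point `0̄ = (0,0,0,…)` of `K` (an endpoint of `K`). -/
def zeroPt (s : ℝ) (hs1 : Real.sqrt 2 < s) : invLim s := by
  refine ⟨fun _ => 0, fun n => ⟨le_refl 0, zero_le_one⟩, fun n => ?_⟩
  have hs0 : 0 ≤ s := le_of_lt (lt_of_le_of_lt (Real.sqrt_nonneg 2) hs1)
  simp [tent]
  exact hs0

theorem tent_cont (s : ℝ) : Continuous (tent s) := by
  unfold tent; fun_prop

theorem tent_lip (s : ℝ) (hs : 0 ≤ s) (x y : ℝ) : |tent s x - tent s y| ≤ s * |x - y| := by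
  unfold tent
  refine (abs_min_sub_min_le_max _ _ _ _).trans (max_le ?_ ?_)
  · rw [← mul_sub, abs_mul, abs_of_nonneg hs]
  · rw [← mul_sub, abs_mul, abs_of_nonneg hs]
    have : (1 - x) - (1 - y) = -(x - y) := by ring
    rw [this, abs_neg]

theorem tent_left (s : ℝ) (hs : 0 ≤ s) {x : ℝ} (hx : x ≤ 1 / 2) : tent s x = s * x :=
  min_eq_left (by nlinarith)

theorem tent_right (s : ℝ) (hs : 0 ≤ s) {x : ℝ} (hx : 1 / 2 ≤ x) : tent s x = s * (1 - x) :=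
  min_eq_right (by nlinarith)

theorem proj_cont (s : ℝ) (n : ℕ) : Continuous (proj s n) :=
  (continuous_apply n).comp continuous_subtype_val

theorem proj_succ (s : ℝ) (n : ℕ) (x : invLim s) : proj s n x = tent s (proj s (n + 1) x) :=
  x.2.2 n

theorem proj_iter (s : ℝ) (n k : ℕ) (x : invLim s) :
    proj s n x = (tent s)^[k] (proj s (n + k) x) := by
  induction k with
  | zero => rfl
  | succ k ih => rw [ih, Function.iterate_succ_apply, ← add_assoc, ← proj_succ]

theorem invLim_compact (s : ℝ) : CompactSpace (invLim s) := by
  rw [← isCompact_iff_compactSpace]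
  refine IsCompact.of_isClosed_subset
    (isCompact_univ_pi (fun _ : ℕ => (isCompact_Icc : IsCompact (Icc (0 : ℝ) 1)))) ?_ ?_
  · have : invLim s = (⋂ n, {x : ℕ → ℝ | x n ∈ Icc (0 : ℝ) 1}) ∩
        ⋂ n, {x : ℕ → ℝ | x n = tent s (x (n + 1))} := by
      ext x; simp [invLim]
    rw [this]
    refine IsClosed.inter (isClosed_iInter fun n => ?_) (isClosed_iInter fun n => ?_)
    · exact isClosed_Icc.preimage (continuous_apply n)
    · exact isClosed_eq (continuous_apply n) ((tent_cont s).comp (continuous_apply (n + 1)))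
  · intro x hx n _
    exact hx.1 n

theorem arc_pre {s : ℝ} {A : Set (invLim s)} {a b : invLim s} (h : IsArcWith A a b) :
    IsPreconnected A := by
  obtain ⟨f, hf, rfl, -, -⟩ := h
  exact isPreconnected_range hf.continuous

theorem arc_img {s : ℝ} {A : Set (invLim s)} {a b : invLim s} (h : IsArcWith A a b) (n : ℕ) :
    OrdConnected (proj s n '' A) :=
  ((arc_pre h).image _ (proj_cont s n).continuousOn).ordConnected

theorem inj_succ {s : ℝ} {A : Set (invLim s)} {n : ℕ} (h : InjOn (proj s n) A) :
    InjOn (proj s (n + 1)) A := by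
  intro x hx y hy hxy
  apply h hx hy
  rw [proj_succ, proj_succ s n y, hxy]

theorem tent_expand {s : ℝ} (hs : 0 < s) {A : Set (invLim s)} {n : ℕ}
    (hc : OrdConnected (proj s (n + 1) '' A)) (h : InjOn (proj s n) A)
    {x y : invLim s} (hx : x ∈ A) (hy : y ∈ A) (hxy : proj s (n + 1) x ≤ proj s (n + 1) y) :
    s * |proj s (n + 1) x - proj s (n + 1) y| = |proj s n x - proj s n y| := by
  rw [proj_succ s n x, proj_succ s n y]
  rcases le_total (proj s (n + 1) y) (1 / 2) with h1 | h1
  · rw [tent_left s hs.le h1, tent_left s hs.le (hxy.trans h1), ← mul_sub, abs_mul,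
      abs_of_pos hs]
  rcases le_total (1 / 2) (proj s (n + 1) x) with h2 | h2
  · rw [tent_right s hs.le h2, tent_right s hs.le (h2.trans hxy), ← mul_sub, abs_mul,
      abs_of_pos hs]
    congr 1
    rw [show (1 - proj s (n + 1) x) - (1 - proj s (n + 1) y)
      = -(proj s (n + 1) x - proj s (n + 1) y) by ring, abs_neg]
  -- 1/2 between x and y
  set u := proj s (n + 1) x with hu
  set v := proj s (n + 1) y with hv
  set e := min (1 / 2 - u) (v - 1 / 2) with he
  have he0 : 0 ≤ e := le_min (by linarith) (by linarith)
  have he1 : e ≤ 1 / 2 - u := min_le_left _ _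
  have he2 : e ≤ v - 1 / 2 := min_le_right _ _
  have hsub := hc.out (mem_image_of_mem _ hx) (mem_image_of_mem _ hy)
  obtain ⟨z, hz, hz'⟩ := hsub (show 1 / 2 - e ∈ Icc u v from ⟨by linarith, by linarith⟩)
  obtain ⟨w, hw, hw'⟩ := hsub (show 1 / 2 + e ∈ Icc u v from ⟨by linarith, by linarith⟩)
  have hzw : z = w := by
    apply h hz hw
    rw [proj_succ, proj_succ s n w, hz', hw', tent_left s hs.le (by linarith),
      tent_right s hs.le (by linarith)]
    ring
  have he00 : e = 0 := by
    rw [hzw, hw'] at hz'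
    linarith
  rcases min_choice (1 / 2 - u) (v - 1 / 2) with h3 | h3
  · have : u = 1 / 2 := by linarith
    rw [tent_right s hs.le h1, tent_right s hs.le this.ge, ← mul_sub, abs_mul, abs_of_pos hs,
      show (1 - u) - (1 - v) = -(u - v) by ring, abs_neg]
  · have : v = 1 / 2 := by linarith
    rw [tent_left s hs.le h2, tent_left s hs.le this.le, ← mul_sub, abs_mul, abs_of_pos hs]

theorem tent_expand' {s : ℝ} (hs : 0 < s) {A : Set (invLim s)} {n : ℕ}
    (hc : OrdConnected (proj s (n + 1) '' A)) (h : InjOn (proj s n) A)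
    {x y : invLim s} (hx : x ∈ A) (hy : y ∈ A) :
    s * |proj s (n + 1) x - proj s (n + 1) y| = |proj s n x - proj s n y| := by
  rcases le_total (proj s (n + 1) x) (proj s (n + 1) y) with h1 | h1
  · exact tent_expand hs hc h hx hy h1
  · rw [abs_sub_comm, abs_sub_comm (proj s n x)]
    exact tent_expand hs hc h hy hx h1

theorem arc_len_up {s : ℝ} (hs : 0 < s) {A : Set (invLim s)} {a b : invLim s}
    (hA : IsArcWith A a b) {m : ℕ} (hi : InjOn (proj s m) A) (k : ℕ) :
    InjOn (proj s (m + k)) A ∧ ∀ x ∈ A, ∀ y ∈ A,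
      s ^ (m + k) * |proj s (m + k) x - proj s (m + k) y| = s ^ m * |proj s m x - proj s m y| := by
  induction k with
  | zero => exact ⟨hi, fun _ _ _ _ => rfl⟩
  | succ k ih =>
    refine ⟨inj_succ ih.1, fun x hx y hy => ?_⟩
    rw [← ih.2 x hx y hy, ← tent_expand' hs (arc_img hA _) ih.1 hx hy]
    rw [← add_assoc, pow_succ]; ring

theorem arc_len_down {s : ℝ} (hs : 0 < s) (n k : ℕ) (x y : invLim s) :
    s ^ n * |proj s n x - proj s n y| ≤ s ^ (n + k) * |proj s (n + k) x - proj s (n + k) y| := by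
  induction k with
  | zero => exact le_rfl
  | succ k ih =>
    refine ih.trans ?_
    have := tent_lip s hs.le (proj s (n + k + 1) x) (proj s (n + k + 1) y)
    rw [← proj_succ, ← proj_succ] at this
    rw [← add_assoc, pow_succ, mul_assoc]
    exact mul_le_mul_of_nonneg_left this (by positivity)

theorem arc_end {s : ℝ} {A : Set (invLim s)} {a b : invLim s}
    (hA : IsArcWith A a b) {m : ℕ} (hi : InjOn (proj s m) A) {x : invLim s} (hx : x ∈ A) :
    |proj s m x - proj s m a| ≤ |proj s m a - proj s m b| := by
  obtain ⟨f, hf, rfl, rfl, rfl⟩ := hA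
  obtain ⟨t, rfl⟩ := hx
  have hc : Continuous (fun t => proj s m (f t)) := (proj_cont s m).comp hf.continuous
  have hinj : Injective (fun t => proj s m (f t)) := fun u v h =>
    hf.injective (hi (mem_range_self u) (mem_range_self v) h)
  rcases hc.strictMono_of_inj hinj with h | h
  · have h0 := h.monotone (unitInterval.nonneg' (t := t))
    have h1 := h.monotone (unitInterval.le_one' (t := t))
    rw [abs_of_nonneg (by linarith), abs_of_nonpos (by linarith)]; linarith
  · have h0 := h.antitone (unitInterval.nonneg' (t := t))
    have h1 := h.antitone (unitInterval.le_one' (t := t))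
    rw [abs_of_nonpos (by linarith), abs_of_nonneg (by linarith)]; linarith

theorem arc_bound {s : ℝ} (hs : 0 < s) {A : Set (invLim s)} {a b : invLim s}
    (hA : IsArcWith A a b) {M : ℝ} {m : ℕ} (hi : InjOn (proj s m) A)
    (hM : s ^ m * |proj s m a - proj s m b| ≤ M) {x : invLim s} (hx : x ∈ A) (n : ℕ) :
    s ^ n * |proj s n x - proj s n a| ≤ M := by
  have haA : a ∈ A := by
    obtain ⟨f, -, rfl, rfl, -⟩ := hA
    exact mem_range_self _
  have h0 : s ^ m * |proj s m x - proj s m a| ≤ M :=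
    (mul_le_mul_of_nonneg_left (arc_end hA hi hx) (by positivity)).trans hM
  rcases le_total n m with h | h
  · obtain ⟨k, rfl⟩ := Nat.exists_eq_add_of_le h
    exact (arc_len_down hs n k x a).trans h0
  · obtain ⟨k, rfl⟩ := Nat.exists_eq_add_of_le h
    rw [(arc_len_up hs hA hi k).2 x hx a haA]
    exact h0

theorem mem_setLimsup_iff {X : Type*} [TopologicalSpace X] [FirstCountableTopology X]
    (D : ℕ → Set X) (y : X) :
    y ∈ setLimsup D ↔ ∀ N, y ∈ closure (⋃ i ≥ N, D i) := by
  constructor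
  · rintro ⟨φ, hφ, z, hz, hlim⟩ N
    refine mem_closure_of_tendsto hlim ?_
    filter_upwards [eventually_ge_atTop N] with k hk
    exact mem_biUnion (show φ k ≥ N from hk.trans (hφ.id_le k)) (hz k)
  · intro h
    obtain ⟨U, hU⟩ := (𝓝 y).exists_antitone_basis
    have : ∀ n, ∃ᶠ k in atTop, ∃ z ∈ D k, z ∈ U n := by
      intro n
      rw [frequently_atTop]
      intro N
      obtain ⟨z, hzU, hz⟩ := mem_closure_iff_nhds.1 (h N) (U n) (hU.1.mem_of_mem trivial)
      simp only [mem_iUnion] at hz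
      obtain ⟨i, hi, hz⟩ := hz
      exact ⟨i, hi, z, hz, hzU⟩
    obtain ⟨φ, hφ, hz⟩ := extraction_forall_of_frequently this
    choose z hz1 hz2 using hz
    exact ⟨φ, hφ, z, hz1, hU.tendsto hz2⟩

theorem setLimsup_closed {X : Type*} [TopologicalSpace X] [FirstCountableTopology X]
    (D : ℕ → Set X) : IsClosed (setLimsup D) := by
  have : setLimsup D = ⋂ N, closure (⋃ i ≥ N, D i) := by
    ext y; rw [mem_setLimsup_iff, mem_iInter]
  rw [this]
  exact isClosed_iInter fun _ => isClosed_closure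

theorem limsup_img {s : ℝ} {A : ℕ → Set (invLim s)} {a b : ℕ → invLim s}
    (hA : ∀ i, IsArcWith (A i) (a i) (b i)) {abar : invLim s}
    (ha : Tendsto a atTop (𝓝 abar)) (n : ℕ) :
    OrdConnected (proj s n '' setLimsup A) := by
  have haA : ∀ i, a i ∈ A i := by
    intro i
    obtain ⟨f, -, h, h', -⟩ := hA i
    rw [← h, ← h']
    exact mem_range_self _
  have hab : abar ∈ setLimsup A := ⟨id, strictMono_id, a, haA, ha⟩
  have := invLim_compact s
  refine ordConnected_of_uIcc_subset_left (x := proj s n abar) ?_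
  rintro _ ⟨x, hx, rfl⟩ t ht
  by_cases h1 : t = proj s n abar
  · exact ⟨abar, hab, h1.symm⟩
  by_cases h2 : t = proj s n x
  · exact ⟨x, hx, h2.symm⟩
  obtain ⟨φ, hφ, z, hz, hlim⟩ := hx
  have la : Tendsto (fun k => proj s n (a (φ k))) atTop (𝓝 (proj s n abar)) :=
    ((proj_cont s n).tendsto _).comp (ha.comp hφ.tendsto_atTop)
  have lz : Tendsto (fun k => proj s n (z k)) atTop (𝓝 (proj s n x)) :=
    ((proj_cont s n).tendsto _).comp hlim
  have hev : ∀ᶠ k in atTop, ∃ w ∈ A (φ k), proj s n w = t := by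
    rw [mem_uIcc] at ht
    rcases ht with ⟨h3, h4⟩ | ⟨h3, h4⟩
    · filter_upwards [la.eventually_lt_const (lt_of_le_of_ne h3 (Ne.symm h1)),
        lz.eventually_const_lt (lt_of_le_of_ne h4 h2)] with k hk1 hk2
      exact (arc_img (hA (φ k)) n).out (mem_image_of_mem _ (haA _)) (mem_image_of_mem _ (hz k))
        ⟨hk1.le, hk2.le⟩
    · filter_upwards [la.eventually_const_lt (lt_of_le_of_ne h4 h1),
        lz.eventually_lt_const (lt_of_le_of_ne h3 (Ne.symm h2))] with k hk1 hk2
      exact (arc_img (hA (φ k)) n).out (mem_image_of_mem _ (hz k)) (mem_image_of_mem _ (haA _))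
        ⟨hk2.le, hk1.le⟩
  obtain ⟨N, hN⟩ := eventually_atTop.1 hev
  choose w hw hwt using fun k => hN (k + N) (Nat.le_add_left _ _)
  obtain ⟨y, ψ, hψ, hy⟩ := CompactSpace.tendsto_subseq w
  refine ⟨y, ⟨fun k => φ (ψ k + N), ?_, w ∘ ψ, fun k => hw _, hy⟩, ?_⟩
  · intro i j hij
    exact hφ (Nat.add_lt_add_right (hψ hij) N)
  · have := ((proj_cont s n).tendsto _).comp hy
    refine tendsto_nhds_unique this ?_
    have : (proj s n ∘ w ∘ ψ) = fun _ => t := by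
      ext k; exact hwt _
    rw [this]
    exact tendsto_const_nhds

theorem arc_of_inj {s : ℝ} {B : Set (invLim s)} (hB : IsClosed B) (hne : B.Nonempty) {m : ℕ}
    (hc : OrdConnected (proj s m '' B)) (hi : InjOn (proj s m) B) : IsArcOrPoint B := by
  have := invLim_compact s
  have hBc : IsCompact B := hB.isCompact
  have himg : proj s m '' B = Icc (sInf (proj s m '' B)) (sSup (proj s m '' B)) :=
    eq_Icc_of_connected_compact ⟨hne.image _, hc.isPreconnected⟩ (hBc.image (proj_cont s m))
  generalize sInf (proj s m '' B) = p at himg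
  generalize sSup (proj s m '' B) = q at himg
  rcases lt_or_ge p q with hpq | hpq
  · left
    have : CompactSpace B := isCompact_iff_compactSpace.1 hBc
    let g : B → Icc p q := fun x => ⟨proj s m x, himg ▸ mem_image_of_mem _ x.2⟩
    have hg : Continuous g := ((proj_cont s m).comp continuous_subtype_val).subtype_mk _
    have hbij : Bijective g := by
      constructor
      · intro x y hxy
        exact Subtype.ext (hi x.2 y.2 (congrArg Subtype.val hxy))
      · rintro ⟨t, ht⟩
        rw [← himg] at ht
        obtain ⟨x, hx, rfl⟩ := ht
        exact ⟨⟨x, hx⟩, rfl⟩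
    let e : B ≃ₜ Icc p q :=
      Continuous.homeoOfEquivCompactToT2 (f := Equiv.ofBijective g hbij) hg
    let e' := (iccHomeoI p q hpq).symm.trans e.symm
    refine ⟨_, _, fun t => (e' t : invLim s),
      Topology.IsEmbedding.subtypeVal.comp e'.isEmbedding, ?_, rfl, rfl⟩
    ext x
    constructor
    · rintro ⟨t, rfl⟩
      exact (e' t).2
    · intro hx
      exact ⟨e'.symm ⟨x, hx⟩, by simp⟩
  · right
    obtain ⟨x, hx⟩ := hne
    refine ⟨x, eq_singleton_iff_unique_mem.2 ⟨hx, fun y hy => hi hy hx ?_⟩⟩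
    have h1 : proj s m x ∈ Icc p q := himg ▸ mem_image_of_mem _ hx
    have h2 : proj s m y ∈ Icc p q := himg ▸ mem_image_of_mem _ hy
    linarith [h1.1, h1.2, h2.1, h2.2]

theorem inj_of_avoid {s : ℝ} (hs : 0 < s) {B : Set (invLim s)} {N : ℕ}
    (hc : ∀ n, OrdConnected (proj s n '' B))
    (hav : ∀ n, N < n → (1 / 2 : ℝ) ∉ proj s n '' B) : InjOn (proj s N) B := by
  intro x hx y hy hxy
  have key : ∀ k, proj s (N + k) x = proj s (N + k) y := by
    intro k
    induction k with
    | zero => exact hxy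
    | succ k ih =>
      have h := hav (N + k + 1) (by omega)
      rw [proj_succ, proj_succ s _ y] at ih
      rw [← add_assoc]
      set u := proj s (N + k + 1) x with hu
      set v := proj s (N + k + 1) y with hv
      have mu : u ∈ proj s (N + k + 1) '' B := mem_image_of_mem _ hx
      have mv : v ∈ proj s (N + k + 1) '' B := mem_image_of_mem _ hy
      rcases le_total u (1 / 2) with h1 | h1 <;> rcases le_total v (1 / 2) with h2 | h2
      · rw [tent_left s hs.le h1, tent_left s hs.le h2] at ih
        exact mul_left_cancel₀ hs.ne' ih
      · exact absurd ((hc _).out mu mv ⟨h1, h2⟩) h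
      · exact absurd ((hc _).out mv mu ⟨h2, h1⟩) h
      · rw [tent_right s hs.le h1, tent_right s hs.le h2] at ih
        linarith [mul_left_cancel₀ hs.ne' ih]
  apply Subtype.ext
  funext n
  rcases le_total N n with h | h
  · obtain ⟨k, rfl⟩ := Nat.exists_eq_add_of_le h
    exact key k
  · obtain ⟨k, rfl⟩ := Nat.exists_eq_add_of_le h
    change proj s n x = proj s n y
    rw [proj_iter s n k x, hxy, ← proj_iter]

/-- Lemma 5.5: if the arcs `A_i` have endpoints `ā_i, b̄_i` with
`d̄(ā_i, b̄_i) ≤ M` and `ā_i` converges, then `limsup A_i` is a (possibly degenerate) arc of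
`d̄`-length at most `2M`. -/
theorem statement6 (s : ℝ) (hs1 : Real.sqrt 2 < s) (hs2 : s < 2)
    (hnr : (1 : ℝ) / 2 ∉ omegaSet (tent s) (1 / 2))
    (A : ℕ → Set (invLim s)) (a b : ℕ → invLim s)
    (hA : ∀ i, IsArcWith (A i) (a i) (b i))
    (M : ℝ) (hM : 0 < M)
    (hd : ∀ i, ∃ m : ℕ, InjOn (proj s m) (A i) ∧
      s ^ m * |proj s m (a i) - proj s m (b i)| ≤ M)
    (abar : invLim s) (ha : Tendsto a atTop (𝓝 abar)) :
    IsArcOrPoint (setLimsup A) ∧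
      ∃ m : ℕ, InjOn (proj s m) (setLimsup A) ∧
        s ^ m * Metric.diam (proj s m '' setLimsup A) ≤ 2 * M := by
  have hs : 1 < s := by
    refine lt_of_le_of_lt ?_ hs1
    rw [Real.le_sqrt] <;> norm_num
  have hs0 : 0 < s := by linarith
  set B := setLimsup A with hBdef
  have haA : ∀ i, a i ∈ A i := by
    intro i
    obtain ⟨f, -, h, h', -⟩ := hA i
    rw [← h, ← h']
    exact mem_range_self _
  have hab : abar ∈ B := ⟨id, strictMono_id, a, haA, ha⟩
  have hcl : IsClosed B := setLimsup_closed A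
  have hc : ∀ n, OrdConnected (proj s n '' B) := limsup_img hA ha
  have hbd : ∀ n, ∀ x ∈ B, s ^ n * |proj s n x - proj s n abar| ≤ M := by
    rintro n x ⟨φ, hφ, z, hz, hlim⟩
    have l1 : Tendsto (fun k => s ^ n * |proj s n (z k) - proj s n (a (φ k))|) atTop
        (𝓝 (s ^ n * |proj s n x - proj s n abar|)) :=
      ((((proj_cont s n).tendsto _).comp hlim).sub
        (((proj_cont s n).tendsto _).comp (ha.comp hφ.tendsto_atTop))).abs.const_mul _
    refine le_of_tendsto' l1 fun k => ?_
    obtain ⟨m, hi, hm⟩ := hd (φ k)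
    exact arc_bound hs0 (hA _) hi hm (hz k) n
  have hbd2 : ∀ n, ∀ x ∈ B, ∀ y ∈ B, s ^ n * |proj s n x - proj s n y| ≤ 2 * M := by
    intro n x hx y hy
    have h1 := hbd n x hx
    have h2 := hbd n y hy
    have h3 : |proj s n x - proj s n y| ≤
        |proj s n x - proj s n abar| + |proj s n y - proj s n abar| := by
      rw [abs_sub_comm (proj s n y)]
      exact abs_sub_le _ _ _
    have := mul_le_mul_of_nonneg_left h3 (by positivity : 0 ≤ s ^ n)
    linarith
  -- non-recurrence
  obtain ⟨ε, hε, K, hK⟩ : ∃ ε > 0, ∃ K : ℕ, ∀ k ≥ K, ε ≤ |(tent s)^[k] (1 / 2) - 1 / 2| := by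
    by_contra hcon
    push Not at hcon
    apply hnr
    have hcl : MapClusterPt (1 / 2 : ℝ) atTop (fun k => (tent s)^[k] (1 / 2)) := by
      rw [Metric.nhds_basis_ball.mapClusterPt_iff_frequently]
      intro ε hε
      rw [frequently_atTop]
      intro K
      obtain ⟨k, hk, h⟩ := hcon ε hε K
      exact ⟨k, hk, by rwa [Metric.mem_ball, Real.dist_eq]⟩
    exact hcl.tendsto_subseq
  obtain ⟨N, hN⟩ : ∃ N, ∀ n, N < n → (1 / 2 : ℝ) ∉ proj s n '' B := by
    obtain ⟨N₀, hN₀⟩ := pow_unbounded_of_one_lt (2 * M / ε) hs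
    by_cases h : ∃ n ≥ N₀, (1 / 2 : ℝ) ∈ proj s n '' B
    · obtain ⟨n, hn, x, hx, hx'⟩ := h
      refine ⟨n + K, fun n' hn' => ?_⟩
      rintro ⟨y, hy, hy'⟩
      obtain ⟨k, rfl⟩ := Nat.exists_eq_add_of_le (show n ≤ n' by omega)
      have h1 := hbd2 n y hy x hx
      rw [proj_iter s n k y, hy', hx'] at h1
      have h2 := hK k (by omega)
      have h3 : 2 * M / ε < s ^ n := hN₀.trans_le (pow_le_pow_right₀ hs.le hn)
      rw [div_lt_iff₀ hε] at h3
      have := mul_le_mul_of_nonneg_left h2 (by positivity : 0 ≤ s ^ n)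
      linarith
    · push Not at h
      exact ⟨N₀, fun n hn => h n hn.le⟩
  have hinj : InjOn (proj s N) B := inj_of_avoid hs0 hc hN
  refine ⟨arc_of_inj hcl ⟨abar, hab⟩ (hc N) hinj, N, hinj, ?_⟩
  have hp : 0 < s ^ N := by positivity
  rw [mul_comm, ← le_div_iff₀ hp]
  refine Metric.diam_le_of_forall_dist_le (by positivity) ?_
  rintro _ ⟨x, hx, rfl⟩ _ ⟨y, hy, rfl⟩
  rw [Real.dist_eq, le_div_iff₀ hp, mul_comm]
  exact hbd2 N x hx y hy
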